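/- arXiv:1510.03289 — 2 statements merged into one kernel-verified Lean document; each statement's English description precedes it below -/
import Mathlib

section
/- Let f : ℝⁿ → ℝ be a C² function such that d²f(x) is positive definite for every x ∈ ℝⁿ. Then ∇f(ℝⁿ) = Int(D_{f*}) is an open convex subset of ℝⁿ, ∇f maps ℝⁿ diffeomorphically onto ∇f(ℝⁿ), and the gradient ∇(f*) : ∇f(ℝⁿ) → ℝⁿ is the inverse of ∇f. -/
open scoped RealInnerProductSpace

/-- The Fenchel conjugate `f*(α) = sup_x (⟨α,x⟩ − f(x))` of a real-valued function. -/
noncomputable def fenchelConjReal {n : ℕ} (f : EuclideanSpace ℝ (Fin n) → ℝ)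
    (α : EuclideanSpace ℝ (Fin n)) : EReal :=
  ⨆ x : EuclideanSpace ℝ (Fin n), ((⟪α, x⟫ : ℝ) : EReal) - ((f x : ℝ) : EReal)

section Gradient

variable {E : Type*} [NormedAddCommGroup E] [InnerProductSpace ℝ E] [CompleteSpace E]
  {f : E → ℝ}

theorem ContDiff.contDiff_gradient (hf : ContDiff ℝ 2 f) : ContDiff ℝ 1 (gradient f) :=
  (InnerProductSpace.toDual ℝ E).symm.toContinuousLinearEquiv.contDiff.comp
    (hf.fderiv_right (by norm_num))

theorem inner_fderiv_gradient (hf : ContDiff ℝ 2 f) (x v w : E) :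
    ⟪fderiv ℝ (gradient f) x v, w⟫ = iteratedFDeriv ℝ 2 f x ![v, w] := by
  have h : HasFDerivAt (fun y => ⟪gradient f y, w⟫)
      ((innerSL ℝ w).comp (fderiv ℝ (gradient f) x)) x := by
    have := (innerSL ℝ w).hasFDerivAt.comp x
      (hf.contDiff_gradient.differentiable one_ne_zero x).hasFDerivAt
    refine this.congr_of_eventuallyEq (.of_forall fun y => ?_)
    simp
  have h' : HasFDerivAt (fun y => ⟪gradient f y, w⟫)
      ((ContinuousLinearMap.apply ℝ ℝ w).comp (fderiv ℝ (fderiv ℝ f) x)) x := by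
    have hd : Differentiable ℝ (fderiv ℝ f) :=
      (hf.fderiv_right (m := 1) (by norm_num)).differentiable one_ne_zero
    refine ((ContinuousLinearMap.apply ℝ ℝ w).hasFDerivAt.comp x
      (hd x).hasFDerivAt).congr_of_eventuallyEq (.of_forall fun y => ?_)
    simp
  have := DFunLike.congr_fun (h.unique h') v
  rw [iteratedFDeriv_two_apply]
  simpa [real_inner_comm] using this

/-- A `C²` function with positive definite Hessian lies strictly above its tangent hyperplanes. -/
theorem add_inner_gradient_lt (hf : ContDiff ℝ 2 f)
    (hpos : ∀ x v : E, v ≠ 0 → 0 < iteratedFDeriv ℝ 2 f x ![v, v]) {x y : E} (hxy : x ≠ y) :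
    f x + ⟪gradient f x, y - x⟫ < f y := by
  have hv : y - x ≠ 0 := sub_ne_zero.mpr hxy.symm
  set v := y - x
  have hline (t : ℝ) : HasDerivAt (fun t : ℝ => x + t • v) v t := by
    simpa using ((hasDerivAt_id t).smul_const v).const_add x
  have hφ (t : ℝ) : HasDerivAt (fun t : ℝ => f (x + t • v)) ⟪gradient f (x + t • v), v⟫ t := by
    rw [inner_gradient_left]
    exact (hf.differentiable two_ne_zero _).hasFDerivAt.comp_hasDerivAt t (hline t)
  have hψ (t : ℝ) : HasDerivAt (fun t : ℝ => ⟪gradient f (x + t • v), v⟫)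
      (iteratedFDeriv ℝ 2 f (x + t • v) ![v, v]) t := by
    rw [← inner_fderiv_gradient hf]
    have := ((hf.contDiff_gradient.differentiable one_ne_zero _).hasFDerivAt.comp_hasDerivAt t
      (hline t)).inner ℝ (hasDerivAt_const t v)
    simpa using this
  have hmono : StrictMono fun t : ℝ => ⟪gradient f (x + t • v), v⟫ :=
    strictMono_of_deriv_pos fun t => by
      rw [(hψ t).deriv]
      exact hpos _ _ hv
  obtain ⟨c, hc, hslope⟩ := exists_hasDerivAt_eq_slope _ _ zero_lt_one
    (fun t _ => (hφ t).continuousAt.continuousWithinAt) (fun t _ => hφ t)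
  have hlt := hmono hc.1
  simp only [zero_smul, add_zero, one_smul, sub_zero, div_one] at hslope hlt
  rw [hslope] at hlt
  have : x + v = y := add_sub_cancel x y
  rw [this] at hlt
  linarith

theorem injective_gradient_of_hessian_pos (hf : ContDiff ℝ 2 f)
    (hpos : ∀ x v : E, v ≠ 0 → 0 < iteratedFDeriv ℝ 2 f x ![v, v]) :
    Function.Injective (gradient f) := by
  intro x y hg
  by_contra hxy
  have h₁ := add_inner_gradient_lt hf hpos hxy
  have h₂ := add_inner_gradient_lt hf hpos (Ne.symm hxy)
  rw [← hg, ← neg_sub y x, inner_neg_right] at h₂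
  linarith

theorem exists_equiv_hasStrictFDerivAt_gradient [FiniteDimensional ℝ E] (hf : ContDiff ℝ 2 f)
    (hpos : ∀ x v : E, v ≠ 0 → 0 < iteratedFDeriv ℝ 2 f x ![v, v]) (x : E) :
    ∃ e : E ≃L[ℝ] E, HasStrictFDerivAt (gradient f) (e : E →L[ℝ] E) x := by
  have hinj : Function.Injective (fderiv ℝ (gradient f) x : E →ₗ[ℝ] E) := by
    rw [injective_iff_map_eq_zero]
    intro v hv
    by_contra hne
    have := hpos x v hne
    rw [← inner_fderiv_gradient hf] at this
    simp_all
  refine ⟨(LinearEquiv.ofInjectiveEndo _ hinj).toContinuousLinearEquiv, ?_⟩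
  convert hf.contDiff_gradient.contDiffAt.hasStrictFDerivAt one_ne_zero using 1
  ext v
  rfl

theorem isOpenEmbedding_gradient [FiniteDimensional ℝ E] (hf : ContDiff ℝ 2 f)
    (hpos : ∀ x v : E, v ≠ 0 → 0 < iteratedFDeriv ℝ 2 f x ![v, v]) :
    Topology.IsOpenEmbedding (gradient f) := by
  choose e he using exists_equiv_hasStrictFDerivAt_gradient hf hpos
  exact .of_continuous_injective_isOpenMap hf.contDiff_gradient.continuous
    (injective_gradient_of_hessian_pos hf hpos) (isOpenMap_of_hasStrictFDerivAt_equiv he)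

/-- The gradient has a left inverse which is `C¹` at every point of the range. -/
theorem exists_contDiffAt_leftInverse_gradient [FiniteDimensional ℝ E] (hf : ContDiff ℝ 2 f)
    (hpos : ∀ x v : E, v ≠ 0 → 0 < iteratedFDeriv ℝ 2 f x ![v, v]) :
    ∃ G : E → E, Function.LeftInverse G (gradient f) ∧ ∀ x, ContDiffAt ℝ 1 G (gradient f x) := by
  have hg := isOpenEmbedding_gradient hf hpos
  let P := hg.toOpenPartialHomeomorph
  have hP (x : E) : P.symm (gradient f x) = x := P.left_inv (by simp [P])
  refine ⟨P.symm, hP, fun x => ?_⟩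
  obtain ⟨e, he⟩ := exists_equiv_hasStrictFDerivAt_gradient hf hpos x
  refine P.contDiffAt_symm (f₀' := e) (by simp [P]) ?_ ?_
  · rw [hP]
    exact he.hasFDerivAt
  · rw [hP]
    exact hf.contDiff_gradient.contDiffAt

end Gradient

section Conjugate

variable {n : ℕ} {f : EuclideanSpace ℝ (Fin n) → ℝ}

theorem fenchelConjReal_le_coe_iff {α : EuclideanSpace ℝ (Fin n)} {C : ℝ} :
    fenchelConjReal f α ≤ C ↔ ∀ x, ⟪α, x⟫ - f x ≤ C := by
  simp only [fenchelConjReal, iSup_le_iff]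
  exact forall_congr' fun x => by norm_cast

theorem fenchelConjReal_ne_top_iff {α : EuclideanSpace ℝ (Fin n)} :
    fenchelConjReal f α ≠ ⊤ ↔ ∃ C : ℝ, ∀ x, ⟪α, x⟫ - f x ≤ C := by
  constructor
  · exact fun h => ⟨_, fenchelConjReal_le_coe_iff.mp (EReal.le_coe_toReal h)⟩
  · rintro ⟨C, hC⟩
    exact ((fenchelConjReal_le_coe_iff.mpr hC).trans_lt (EReal.coe_lt_top C)).ne

theorem convex_setOf_fenchelConjReal_ne_top (f : EuclideanSpace ℝ (Fin n) → ℝ) :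
    Convex ℝ {α | fenchelConjReal f α ≠ ⊤} := by
  intro α hα β hβ a b ha hb hab
  obtain ⟨C, hC⟩ := fenchelConjReal_ne_top_iff.mp hα
  obtain ⟨D, hD⟩ := fenchelConjReal_ne_top_iff.mp hβ
  refine fenchelConjReal_ne_top_iff.mpr ⟨a * C + b * D, fun x => ?_⟩
  calc ⟪a • α + b • β, x⟫ - f x = a * (⟪α, x⟫ - f x) + b * (⟪β, x⟫ - f x) := by
        rw [inner_add_left, real_inner_smul_left, real_inner_smul_left]
        linear_combination f x * hab
    _ ≤ a * C + b * D := by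
        gcongr
        exacts [hC x, hD x]

theorem fenchelConjReal_gradient (hf : ContDiff ℝ 2 f)
    (hpos : ∀ x v, v ≠ 0 → 0 < iteratedFDeriv ℝ 2 f x ![v, v]) (x : EuclideanSpace ℝ (Fin n)) :
    fenchelConjReal f (gradient f x) = ((⟪gradient f x, x⟫ - f x : ℝ) : EReal) := by
  refine le_antisymm (fenchelConjReal_le_coe_iff.mpr fun y => ?_) ?_
  · obtain rfl | hxy := eq_or_ne x y
    · rfl
    · have := add_inner_gradient_lt hf hpos hxy
      rw [inner_sub_right] at this
      linarith
  · exact le_iSup (fun y => ((⟪gradient f x, y⟫ : ℝ) : EReal) - ((f y : ℝ) : EReal)) x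

/-- In the interior of the domain of the conjugate, sublevel sets of `f - ⟪α, ·⟫` are bounded. -/
theorem isBounded_setOf_sub_inner_le {α : EuclideanSpace ℝ (Fin n)}
    (hα : α ∈ interior {α | fenchelConjReal f α ≠ ⊤}) (c : ℝ) :
    Bornology.IsBounded {x | f x - ⟪α, x⟫ ≤ c} := by
  have hdir (v : EuclideanSpace ℝ (Fin n)) :
      ∃ r > 0, ∃ C : ℝ, ∀ x, r * ⟪v, x⟫ + ⟪α, x⟫ - f x ≤ C := by
    have hcont : Filter.Tendsto (fun r : ℝ => α + r • v) (nhdsWithin 0 (Set.Ioi 0)) (nhds α) := by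
      have : Continuous fun r : ℝ => α + r • v := by fun_prop
      simpa using (this.tendsto 0).mono_left nhdsWithin_le_nhds
    obtain ⟨r, hr, hr0⟩ := ((hcont.eventually (mem_interior_iff_mem_nhds.mp hα)).and
      self_mem_nhdsWithin).exists
    obtain ⟨C, hC⟩ := fenchelConjReal_ne_top_iff.mp hr
    refine ⟨r, hr0, C, fun x => ?_⟩
    have := hC x
    rw [inner_add_left, real_inner_smul_left] at this
    linarith
  have hbound (v : EuclideanSpace ℝ (Fin n)) :
      ∃ M : ℝ, ∀ x ∈ {x | f x - ⟪α, x⟫ ≤ c}, ⟪v, x⟫ ≤ M := by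
    obtain ⟨r, hr, C, hC⟩ := hdir v
    refine ⟨(C + c) / r, fun x hx => ?_⟩
    rw [le_div_iff₀ hr]
    have := hC x
    rw [Set.mem_ofPred_eq] at hx
    linarith
  choose M hM using hbound
  let b := EuclideanSpace.basisFun (Fin n) ℝ
  refine isBounded_iff_forall_norm_le.mpr ⟨∑ i, max (M (b i)) (M (-b i)), fun x hx => ?_⟩
  calc ‖x‖ = ‖∑ i, ⟪b i, x⟫ • b i‖ := by rw [b.sum_repr' x]
    _ ≤ ∑ i, ‖⟪b i, x⟫ • b i‖ := norm_sum_le _ _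
    _ ≤ ∑ i, max (M (b i)) (M (-b i)) := by
        refine Finset.sum_le_sum fun i _ => ?_
        rw [norm_smul, b.norm_eq_one, mul_one, Real.norm_eq_abs, abs_eq_max_neg,
          ← inner_neg_left]
        exact max_le_max (hM _ x hx) (hM _ x hx)

theorem interior_domain_subset_range_gradient (hf : Differentiable ℝ f) :
    interior {α | fenchelConjReal f α ≠ ⊤} ⊆ Set.range (gradient f) := by
  intro α hα
  have hcont : Continuous fun x => f x - ⟪α, x⟫ := by
    have := hf.continuous
    fun_prop
  have hcompact : IsCompact {x | f x - ⟪α, x⟫ ≤ f 0 - ⟪α, (0 : EuclideanSpace ℝ (Fin n))⟫} :=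
    Metric.isCompact_of_isClosed_isBounded (isClosed_le hcont continuous_const)
      (isBounded_setOf_sub_inner_le hα _)
  obtain ⟨x, hx, hmin⟩ := hcompact.exists_isMinOn ⟨0, by simp⟩ hcont.continuousOn
  have hglobal (y) : f x - ⟪α, x⟫ ≤ f y - ⟪α, y⟫ := by
    by_cases hy : f y - ⟪α, y⟫ ≤ f 0 - ⟪α, (0 : EuclideanSpace ℝ (Fin n))⟫
    · exact hmin hy
    · exact hx.trans (not_le.mp hy).le
  have hzero := IsLocalMin.hasFDerivAt_eq_zero (Filter.Eventually.of_forall hglobal)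
    ((hf x).hasFDerivAt.sub (innerSL ℝ α).hasFDerivAt)
  refine ⟨x, ext_inner_right ℝ fun v => ?_⟩
  rw [inner_gradient_left, sub_eq_zero.mp hzero, innerSL_apply_apply]

theorem range_gradient_eq_interior_domain (hf : ContDiff ℝ 2 f)
    (hpos : ∀ x v, v ≠ 0 → 0 < iteratedFDeriv ℝ 2 f x ![v, v]) :
    Set.range (gradient f) = interior {α | fenchelConjReal f α ≠ ⊤} := by
  refine (interior_maximal ?_ (isOpenEmbedding_gradient hf hpos).isOpen_range).antisymm
    (interior_domain_subset_range_gradient (hf.differentiable two_ne_zero))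
  rintro _ ⟨x, rfl⟩
  rw [Set.mem_ofPred_eq, fenchelConjReal_gradient hf hpos]
  exact EReal.coe_ne_top _

theorem hasGradientAt_toReal_fenchelConjReal (hf : ContDiff ℝ 2 f)
    (hpos : ∀ x v, v ≠ 0 → 0 < iteratedFDeriv ℝ 2 f x ![v, v]) (x : EuclideanSpace ℝ (Fin n)) :
    HasGradientAt (fun α => (fenchelConjReal f α).toReal) x (gradient f x) := by
  obtain ⟨G, hG, hGd⟩ := exists_contDiffAt_leftInverse_gradient hf hpos
  have hG' := ((hGd x).differentiableAt one_ne_zero).hasFDerivAt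
  have hf' : HasFDerivAt f (fderiv ℝ f x) (G (gradient f x)) := by
    rw [hG x]
    exact (hf.differentiable two_ne_zero x).hasFDerivAt
  have hformula : (fun α => (fenchelConjReal f α).toReal) =ᶠ[nhds (gradient f x)]
      fun α => ⟪α, G α⟫ - f (G α) := by
    filter_upwards [(isOpenEmbedding_gradient hf hpos).isOpen_range.mem_nhds
      (Set.mem_range_self x)]
    rintro _ ⟨y, rfl⟩
    rw [fenchelConjReal_gradient hf hpos, EReal.toReal_coe, hG y]
  rw [hasGradientAt_iff_hasFDerivAt]
  refine HasFDerivAt.congr_of_eventuallyEq ?_ hformula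
  refine (((hasFDerivAt_id _).inner ℝ hG').sub (hf'.comp _ hG')).congr_fderiv ?_
  ext v
  simp [hG x, real_inner_comm]

end Conjugate

/-- Let `f : ℝⁿ → ℝ` be `C²` with `d²f(x)` positive definite everywhere.
Then `∇f(ℝⁿ) = Int(D_{f*})` is an open convex set, `∇f` maps `ℝⁿ` diffeomorphically onto
`∇f(ℝⁿ)`, and `∇(f*)` is the inverse of `∇f`. -/
theorem gradient_range_eq_interior_domain_conj
    {n : ℕ} (f : EuclideanSpace ℝ (Fin n) → ℝ)
    (hC2 : ContDiff ℝ 2 f)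
    (hpos : ∀ x : EuclideanSpace ℝ (Fin n), ∀ v : EuclideanSpace ℝ (Fin n), v ≠ 0 →
      0 < iteratedFDeriv ℝ 2 f x ![v, v])
    (fstar : EuclideanSpace ℝ (Fin n) → ℝ)
    (hfstar : ∀ α, fstar α = (fenchelConjReal f α).toReal) :
    Set.range (gradient f) = interior {α | fenchelConjReal f α ≠ ⊤} ∧
    IsOpen (Set.range (gradient f)) ∧
    Convex ℝ (Set.range (gradient f)) ∧
    Function.Injective (gradient f) ∧
    ContDiffOn ℝ 1 (gradient fstar) (Set.range (gradient f)) ∧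
    (∀ x, gradient fstar (gradient f x) = x) ∧
    (∀ α ∈ Set.range (gradient f), gradient f (gradient fstar α) = α) := by
  obtain rfl : fstar = fun α => (fenchelConjReal f α).toReal := funext hfstar
  have hrange := range_gradient_eq_interior_domain hC2 hpos
  have hgrad x := (hasGradientAt_toReal_fenchelConjReal hC2 hpos x).gradient
  refine ⟨hrange, (isOpenEmbedding_gradient hC2 hpos).isOpen_range, ?_,
    injective_gradient_of_hessian_pos hC2 hpos, ?_, hgrad, ?_⟩
  · rw [hrange]
    exact (convex_setOf_fenchelConjReal_ne_top f).interior
  · obtain ⟨G, hG, hGd⟩ := exists_contDiffAt_leftInverse_gradient hC2 hpos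
    have hGon : ContDiffOn ℝ 1 G (Set.range (gradient f)) := by
      rintro _ ⟨x, rfl⟩
      exact (hGd x).contDiffWithinAt
    refine hGon.congr ?_
    rintro _ ⟨x, rfl⟩
    rw [hgrad, hG x]
  · rintro _ ⟨x, rfl⟩
    rw [hgrad]
end

section
/- Let μ be a nonzero positive Borel measure on ℝⁿ whose Laplace transform is finite everywhere, i.e. D_{L(μ)} = ℝⁿ. Then the image of ℝⁿ under the gradient of log L(μ) equals the relative interior of C_μ: ∇(log L(μ))(ℝⁿ) = algint(C_μ). -/
open scoped RealInnerProductSpace ENNReal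
open MeasureTheory

/-- The Laplace transform `L(μ)(x) = ∫ e^{⟨α,x⟩} dμ(α) ∈ (0,+∞]` of a positive Borel
measure `μ` on `ℝⁿ`. -/
noncomputable def laplaceT {n : ℕ} (μ : Measure (EuclideanSpace ℝ (Fin n)))
    (x : EuclideanSpace ℝ (Fin n)) : ℝ≥0∞ :=
  ∫⁻ α, ENNReal.ofReal (Real.exp ⟪α, x⟫) ∂μ

/-- The support of a measure: points all of whose open neighbourhoods have positive measure. -/
def measSupport {n : ℕ} (μ : Measure (EuclideanSpace ℝ (Fin n))) :
    Set (EuclideanSpace ℝ (Fin n)) :=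
  {x | ∀ V : Set (EuclideanSpace ℝ (Fin n)), x ∈ V → IsOpen V → 0 < μ V}

section Auxiliary

open scoped Gradient Topology
open Set Filter

section IntrinsicInterior

variable {E : Type*} [NormedAddCommGroup E] [InnerProductSpace ℝ E]

theorem inner_sub_eq_zero_of_mem_intrinsicInterior {K : Set E} {y v : E}
    (hy : y ∈ intrinsicInterior ℝ K) (hv : ∀ a ∈ K, ⟪a - y, v⟫ ≤ 0) {a : E} (ha : a ∈ K) :
    ⟪a - y, v⟫ = 0 := by
  obtain ⟨p, hp, rfl⟩ := hy
  have : Nonempty (affineSpan ℝ K) := ⟨p⟩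
  let q : affineSpan ℝ K := ⟨a, subset_affineSpan ℝ K ha⟩
  have hc : Continuous fun t : ℝ => AffineMap.lineMap p q t := AffineMap.lineMap_continuous
  have h0 : ∀ᶠ t : ℝ in 𝓝 0, ((AffineMap.lineMap p q t : affineSpan ℝ K) : E) ∈ K := by
    have := hc.continuousAt (x := 0)
    refine this.eventually (p := fun z : affineSpan ℝ K => (z : E) ∈ K) ?_
    change _ ∈ 𝓝 (AffineMap.lineMap p q (0 : ℝ))
    rw [AffineMap.lineMap_apply_zero]
    exact mem_interior_iff_mem_nhds.1 hp
  obtain ⟨ε, hε, h⟩ := Metric.eventually_nhds_iff.1 h0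
  have h1 := hv _ (h (y := -(ε / 2)) (by simp [abs_of_pos hε, hε]))
  have h2 : ((AffineMap.lineMap p q (-(ε / 2)) : affineSpan ℝ K) : E) - p
      = (-(ε / 2)) • (a - p) := by
    simp [AffineMap.lineMap_apply, q]
  rw [h2, inner_smul_left] at h1
  simp only [conj_trivial] at h1
  have h3 := hv a ha
  nlinarith

theorem mem_intrinsicInterior_of_forall_inner [FiniteDimensional ℝ E] {K : Set E} {y : E}
    (hK : Convex ℝ K) (hcl : IsClosed K) (hne : K.Nonempty)
    (h : ∀ v, (∀ a ∈ K, ⟪a - y, v⟫ ≤ 0) → ∀ a ∈ K, ⟪a - y, v⟫ = 0) :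
    y ∈ intrinsicInterior ℝ K := by
  have hyK : y ∈ K := by
    by_contra hy
    obtain ⟨f, u, hfu, hu⟩ := geometric_hahn_banach_closed_point hK hcl hy
    have key : ∀ a, ⟪a - y, (InnerProductSpace.toDual ℝ E).symm f⟫ = f a - f y := fun a => by
      rw [real_inner_comm, InnerProductSpace.toDual_symm_apply, map_sub]
    obtain ⟨a, ha⟩ := hne
    have := h _ (fun b hb => by rw [key]; linarith [hfu b hb]) a ha
    rw [key] at this
    linarith [hfu a ha]
  let p : affineSpan ℝ K := ⟨y, subset_affineSpan ℝ K hyK⟩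
  have : Nonempty (affineSpan ℝ K) := ⟨p⟩
  let e : (affineSpan ℝ K).direction ≃ₜ affineSpan ℝ K :=
    (AffineIsometryEquiv.vaddConst ℝ p).toHomeomorph
  have he : ∀ w, ((e w : affineSpan ℝ K) : E) = (w : E) + y := fun w => rfl
  let A : Set (affineSpan ℝ K) := (↑) ⁻¹' K
  let C := e ⁻¹' A
  have hC : Convex ℝ C := by
    intro w hw z hz a b ha hb hab
    have : a • ((w : E) + y) + b • ((z : E) + y) ∈ K := hK hw hz ha hb hab
    change ((a • w + b • z : (affineSpan ℝ K).direction) : E) + y ∈ K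
    convert this using 1
    rw [smul_add, smul_add, add_add_add_comm, ← add_smul, hab, one_smul]
    rfl
  have hCA : interior C = e ⁻¹' interior A := (e.preimage_interior A).symm
  have hint : (interior C).Nonempty := by
    obtain ⟨-, z, hz, rfl⟩ := hne.intrinsicInterior hK
    exact ⟨e.symm z, by rw [hCA]; simpa using hz⟩
  have h0 : (0 : (affineSpan ℝ K).direction) ∈ interior C := by
    by_contra h0
    obtain ⟨f, hf⟩ := geometric_hahn_banach_open_point hC.interior isOpen_interior h0
    simp only [map_zero] at hf
    have hle : ∀ w ∈ C, f w ≤ 0 := by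
      intro w hw
      have hw' : w ∈ closure (interior C) := by
        rw [hC.closure_interior_eq_closure_of_nonempty_interior hint]
        exact subset_closure hw
      exact closure_minimal (fun z hz => (hf z hz).le) (isClosed_Iic.preimage f.continuous) hw'
    let v := (InnerProductSpace.toDual ℝ (affineSpan ℝ K).direction).symm f
    have key : ∀ w : (affineSpan ℝ K).direction, ⟪(w : E), (v : E)⟫ = f w := fun w => by
      rw [← Submodule.coe_inner, real_inner_comm, InnerProductSpace.toDual_symm_apply]
    have hz := h v fun a ha => by
      have h2 := hle (e.symm ⟨a, subset_affineSpan ℝ K ha⟩) (by simpa [C, A] using ha)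
      rw [← key] at h2
      have h3 := he (e.symm ⟨a, subset_affineSpan ℝ K ha⟩)
      rw [e.apply_symm_apply] at h3
      rwa [eq_sub_of_add_eq h3.symm] at h2
    obtain ⟨w, hw⟩ := hint
    have h4 := hz (e w) (interior_subset hw : w ∈ C)
    rw [he, add_sub_cancel_right, key] at h4
    exact (hf w hw).ne h4
  exact ⟨e 0, by rw [hCA] at h0; exact h0, by simp [he]⟩

end IntrinsicInterior

section Support

variable {n : ℕ} (μ : Measure (EuclideanSpace ℝ (Fin n)))

theorem measSupport_eq_support : measSupport μ = μ.support := by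
  rw [Measure.support_eq_forall_isOpen]
  rfl

theorem ae_iff_forall_mem_closure_convexHull {v y : EuclideanSpace ℝ (Fin n)} :
    (∀ᵐ a ∂μ, ⟪a - y, v⟫ ≤ 0) ↔
      ∀ a ∈ closure (convexHull ℝ (measSupport μ)), ⟪a - y, v⟫ ≤ 0 := by
  rw [measSupport_eq_support]
  constructor
  · intro h
    have hcl : IsClosed {a : EuclideanSpace ℝ (Fin n) | ⟪a - y, v⟫ ≤ 0} :=
      isClosed_le (by fun_prop) continuous_const
    refine closure_minimal (convexHull_min (Measure.support_subset_of_isClosed hcl h) ?_) hcl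
    intro a ha b hb s t hs ht hst
    have h1 : s • a + t • b - y = s • (a - y) + t • (b - y) := by
      have : y = (s + t) • y := by rw [hst, one_smul]
      nth_rw 1 [this]
      module
    change ⟪a - y, v⟫ ≤ 0 at ha
    change ⟪b - y, v⟫ ≤ 0 at hb
    change ⟪s • a + t • b - y, v⟫ ≤ 0
    rw [h1, inner_add_left, real_inner_smul_left, real_inner_smul_left]
    nlinarith
  · intro h
    filter_upwards [Measure.support_mem_ae (μ := μ)] with a ha
    exact h a (subset_closure (subset_convexHull ℝ _ ha))

theorem mem_intrinsicInterior_closure_convexHull_measSupport (hμ : μ ≠ 0)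
    {y : EuclideanSpace ℝ (Fin n)} :
    y ∈ intrinsicInterior ℝ (closure (convexHull ℝ (measSupport μ))) ↔
      ∀ v, (∀ᵐ a ∂μ, ⟪a - y, v⟫ ≤ 0) → ∀ᵐ a ∂μ, ⟪a - y, v⟫ = 0 := by
  constructor
  · intro hy v hv
    rw [ae_iff_forall_mem_closure_convexHull] at hv
    filter_upwards [Measure.support_mem_ae (μ := μ)] with a ha
    rw [← measSupport_eq_support] at ha
    exact inner_sub_eq_zero_of_mem_intrinsicInterior hy hv
      (subset_closure (subset_convexHull ℝ _ ha))
  · intro h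
    refine mem_intrinsicInterior_of_forall_inner (convex_convexHull ℝ _).closure isClosed_closure
      ?_ fun v hv a ha => (hv a ha).antisymm ?_
    · rw [measSupport_eq_support]
      exact (Measure.nonempty_support hμ).convexHull.closure
    · have h1 := h v ((ae_iff_forall_mem_closure_convexHull μ).2 hv)
      have h2 : ∀ᵐ a ∂μ, ⟪a - y, -v⟫ ≤ 0 :=
        h1.mono fun a ha => by rw [inner_neg_right, ha, neg_zero]
      have := (ae_iff_forall_mem_closure_convexHull μ).1 h2 a ha
      rwa [inner_neg_right, neg_nonpos] at this

end Support

section Laplace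

variable {n : ℕ} {μ : Measure (EuclideanSpace ℝ (Fin n))}

theorem integrable_exp_inner (hfin : ∀ x, laplaceT μ x ≠ ⊤) (x : EuclideanSpace ℝ (Fin n)) :
    Integrable (fun a => Real.exp ⟪a, x⟫) μ := by
  refine (lintegral_ofReal_ne_top_iff_integrable (by fun_prop)
    (ae_of_all _ fun a => (Real.exp_pos _).le)).1 (hfin x)

theorem laplaceT_toReal (x : EuclideanSpace ℝ (Fin n)) :
    (laplaceT μ x).toReal = ∫ a, Real.exp ⟪a, x⟫ ∂μ := by
  rw [integral_eq_lintegral_of_nonneg_ae (ae_of_all _ fun a => (Real.exp_pos _).le) (by fun_prop)]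
  rfl

theorem EuclideanSpace.exp_mul_norm_le (c : ℝ) (hc : 0 ≤ c) (a : EuclideanSpace ℝ (Fin n)) :
    Real.exp (c * ‖a‖) ≤ 1 + ∑ i, Real.exp (c * n * |a i|) := by
  rcases isEmpty_or_nonempty (Fin n) with hn | hn
  · have : a = 0 := Subsingleton.elim _ _
    simp [this]
  obtain ⟨i, hi⟩ := Finite.exists_max fun i => |a i|
  have hn1 : (1 : ℝ) ≤ n := by exact_mod_cast Fin.pos_iff_nonempty.2 hn
  have h1 : ‖a‖ ≤ n * |a i| := by
    refine le_of_sq_le_sq ?_ (by positivity)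
    rw [EuclideanSpace.real_norm_sq_eq]
    calc ∑ j, a j ^ 2 ≤ ∑ _j : Fin n, |a i| ^ 2 :=
          Finset.sum_le_sum fun j _ => sq_le_sq.2 (by simpa using hi j)
      _ = n * |a i| ^ 2 := by simp
      _ ≤ (n * |a i|) ^ 2 := by
          nlinarith [mul_nonneg (sub_nonneg.2 hn1)
            (mul_nonneg (zero_le_one.trans hn1) (sq_nonneg |a i|))]
  calc Real.exp (c * ‖a‖) ≤ Real.exp (c * n * |a i|) := by
        rw [mul_assoc]; gcongr
    _ ≤ ∑ i, Real.exp (c * n * |a i|) :=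
        Finset.single_le_sum (f := fun i => Real.exp (c * n * |a i|))
          (fun j _ => (Real.exp_pos _).le) (Finset.mem_univ i)
    _ ≤ _ := by linarith

theorem integrable_exp_mul_norm (hfin : ∀ x, laplaceT μ x ≠ ⊤) (c : ℝ) (hc : 0 ≤ c) :
    Integrable (fun a => Real.exp (c * ‖a‖)) μ := by
  have h1 : Integrable (fun a : EuclideanSpace ℝ (Fin n) =>
      1 + ∑ i, Real.exp (c * n * |a i|)) μ := by
    refine Integrable.add ?_ (integrable_finsetSum _ fun i _ => ?_)
    · simpa using integrable_exp_inner hfin 0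
    · have key : ∀ t : ℝ, Integrable (fun a : EuclideanSpace ℝ (Fin n) => Real.exp (t * a i)) μ :=
        fun t => by
          simpa [EuclideanSpace.inner_single_right] using
            integrable_exp_inner hfin (EuclideanSpace.single i t)
      exact ProbabilityTheory.integrable_exp_mul_abs (key _) (key _)
  refine h1.mono' (by fun_prop) (ae_of_all _ fun a => ?_)
  rw [Real.norm_of_nonneg (Real.exp_pos _).le]
  exact EuclideanSpace.exp_mul_norm_le c hc a

theorem exp_inner_mul_norm_le {a x : EuclideanSpace ℝ (Fin n)} {r : ℝ} (hx : ‖x‖ ≤ r) :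
    Real.exp ⟪a, x⟫ * ‖a‖ ≤ Real.exp ((r + 1) * ‖a‖) := by
  rw [add_mul, Real.exp_add]
  gcongr
  · calc ⟪a, x⟫ ≤ ‖a‖ * ‖x‖ := real_inner_le_norm _ _
      _ ≤ r * ‖a‖ := by rw [mul_comm]; gcongr
  · linarith [Real.add_one_le_exp (1 * ‖a‖)]

theorem integrable_exp_inner_smul (hfin : ∀ x, laplaceT μ x ≠ ⊤)
    (x : EuclideanSpace ℝ (Fin n)) : Integrable (fun a => Real.exp ⟪a, x⟫ • a) μ := by
  refine (integrable_exp_mul_norm hfin (‖x‖ + 1) (by positivity)).mono' (by fun_prop)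
    (ae_of_all _ fun a => ?_)
  rw [norm_smul, Real.norm_of_nonneg (Real.exp_pos _).le]
  exact exp_inner_mul_norm_le le_rfl

theorem integral_exp_inner_pos (hμ : μ ≠ 0) (hfin : ∀ x, laplaceT μ x ≠ ⊤)
    (x : EuclideanSpace ℝ (Fin n)) : 0 < ∫ a, Real.exp ⟪a, x⟫ ∂μ := by
  have : NeZero μ := ⟨hμ⟩
  exact integral_exp_pos (integrable_exp_inner hfin x)

theorem hasGradientAt_integral_exp_inner (hfin : ∀ x, laplaceT μ x ≠ ⊤)
    (x : EuclideanSpace ℝ (Fin n)) :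
    HasGradientAt (fun x => ∫ a, Real.exp ⟪a, x⟫ ∂μ) (∫ a, Real.exp ⟪a, x⟫ • a ∂μ) x := by
  rw [hasGradientAt_iff_hasFDerivAt]
  have h := hasFDerivAt_integral_of_dominated_of_fderiv_le (𝕜 := ℝ) (μ := μ) (x₀ := x)
    (s := Metric.ball x 1) (F := fun x (a : EuclideanSpace ℝ (Fin n)) => Real.exp ⟪a, x⟫)
    (F' := fun x (a : EuclideanSpace ℝ (Fin n)) => InnerProductSpace.toDual ℝ _ (Real.exp ⟪a, x⟫ • a))
    (bound := fun a : EuclideanSpace ℝ (Fin n) => Real.exp ((‖x‖ + 1 + 1) * ‖a‖))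
    (Metric.ball_mem_nhds x one_pos) (Eventually.of_forall fun z => by fun_prop)
    (integrable_exp_inner hfin x)
    ((InnerProductSpace.toDual ℝ _).continuous.comp_aestronglyMeasurable
      (integrable_exp_inner_smul hfin x).aestronglyMeasurable) ?_
    (integrable_exp_mul_norm hfin _ (by positivity)) ?_
  · have e : InnerProductSpace.toDual ℝ _ (∫ a, Real.exp ⟪a, x⟫ • a ∂μ) =
        ∫ a, InnerProductSpace.toDual ℝ _ (Real.exp ⟪a, x⟫ • a) ∂μ :=
      ((InnerProductSpace.toDual ℝ
        (EuclideanSpace ℝ (Fin n))).toContinuousLinearEquiv.integral_comp_comm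
          (μ := μ) fun a => Real.exp ⟪a, x⟫ • a).symm
    rw [e]
    exact h
  · refine ae_of_all _ fun a z hz => ?_
    rw [LinearIsometryEquiv.norm_map, norm_smul, Real.norm_of_nonneg (Real.exp_pos _).le]
    refine exp_inner_mul_norm_le ?_
    have := norm_le_norm_add_norm_sub' z x
    rw [Metric.mem_ball, dist_eq_norm] at hz
    linarith
  · refine ae_of_all _ fun a z _ => ?_
    have h1 : HasFDerivAt (fun z => ⟪a, z⟫) (innerSL ℝ a) z := (innerSL ℝ a).hasFDerivAt
    rw [map_smul]
    exact h1.exp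

theorem hasGradientAt_log_laplaceT (hμ : μ ≠ 0) (hfin : ∀ x, laplaceT μ x ≠ ⊤)
    (x : EuclideanSpace ℝ (Fin n)) :
    HasGradientAt (fun x => Real.log (laplaceT μ x).toReal)
      ((∫ a, Real.exp ⟪a, x⟫ ∂μ)⁻¹ • ∫ a, Real.exp ⟪a, x⟫ • a ∂μ) x := by
  simp only [laplaceT_toReal]
  have h := (hasGradientAt_integral_exp_inner hfin x).hasFDerivAt.log
    (integral_exp_inner_pos hμ hfin x).ne'
  rw [hasGradientAt_iff_hasFDerivAt]
  rw [map_smul]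
  exact h

theorem integral_exp_inner_mul_inner_sub (hfin : ∀ x, laplaceT μ x ≠ ⊤)
    (x y v : EuclideanSpace ℝ (Fin n)) :
    Integrable (fun a => Real.exp ⟪a, x⟫ * ⟪a - y, v⟫) μ ∧
    ∫ a, Real.exp ⟪a, x⟫ * ⟪a - y, v⟫ ∂μ =
      ⟪∫ a, Real.exp ⟪a, x⟫ • a ∂μ, v⟫ - (∫ a, Real.exp ⟪a, x⟫ ∂μ) * ⟪y, v⟫ := by
  have h1 : Integrable (fun a => ⟪v, Real.exp ⟪a, x⟫ • a⟫) μ :=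
    (integrable_exp_inner_smul hfin x).const_inner v
  have h2 : Integrable (fun a => Real.exp ⟪a, x⟫ * ⟪y, v⟫) μ :=
    (integrable_exp_inner hfin x).mul_const _
  have h3 : (fun a => Real.exp ⟪a, x⟫ * ⟪a - y, v⟫) =
      fun a => ⟪v, Real.exp ⟪a, x⟫ • a⟫ - Real.exp ⟪a, x⟫ * ⟪y, v⟫ := by
    ext a
    rw [inner_sub_left, real_inner_smul_right, real_inner_comm v a]
    ring
  rw [h3]
  refine ⟨h1.sub h2, ?_⟩
  rw [integral_sub h1 h2, integral_inner (integrable_exp_inner_smul hfin x), integral_mul_const,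
    real_inner_comm]

theorem inner_gradient_sub (hμ : μ ≠ 0) (hfin : ∀ x, laplaceT μ x ≠ ⊤)
    (x y v : EuclideanSpace ℝ (Fin n)) :
    ∫ a, Real.exp ⟪a, x⟫ * ⟪a - y, v⟫ ∂μ = (∫ a, Real.exp ⟪a, x⟫ ∂μ) *
      ⟪∇ (fun x => Real.log (laplaceT μ x).toReal) x - y, v⟫ := by
  rw [(integral_exp_inner_mul_inner_sub hfin x y v).2,
    (hasGradientAt_log_laplaceT hμ hfin x).gradient, inner_sub_left, real_inner_smul_left,
    mul_sub, mul_inv_cancel_left₀ (integral_exp_inner_pos hμ hfin x).ne']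

theorem gradient_log_laplaceT_mem (hμ : μ ≠ 0) (hfin : ∀ x, laplaceT μ x ≠ ⊤)
    (x : EuclideanSpace ℝ (Fin n)) :
    ∇ (fun x => Real.log (laplaceT μ x).toReal) x ∈
      intrinsicInterior ℝ (closure (convexHull ℝ (measSupport μ))) := by
  rw [mem_intrinsicInterior_closure_convexHull_measSupport μ hμ]
  intro v hv
  set y := ∇ (fun x => Real.log (laplaceT μ x).toReal) x with hy
  have h := inner_gradient_sub hμ hfin x y v
  rw [← hy, sub_self, inner_zero_left, mul_zero] at h
  have h0 : 0 ≤ᵐ[μ] fun a => -(Real.exp ⟪a, x⟫ * ⟪a - y, v⟫) := by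
    filter_upwards [hv] with a ha
    exact neg_nonneg.2 (mul_nonpos_of_nonneg_of_nonpos (Real.exp_pos _).le ha)
  have h1 := (integral_eq_zero_iff_of_nonneg_ae h0
    (integral_exp_inner_mul_inner_sub hfin x y v).1.neg).1 (by rw [integral_neg, h, neg_zero])
  filter_upwards [h1] with a ha
  simpa using ha

/-- The vectors `v` for which `⟪a - y, v⟫` vanishes for `μ`-almost every `a`. -/
def aeOrthogonal (μ : Measure (EuclideanSpace ℝ (Fin n))) (y : EuclideanSpace ℝ (Fin n)) :
    Submodule ℝ (EuclideanSpace ℝ (Fin n)) where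
  carrier := {v | ∀ᵐ a ∂μ, ⟪a - y, v⟫ = 0}
  add_mem' hv hw := by
    change ∀ᵐ a ∂μ, _ = 0 at hv hw ⊢
    filter_upwards [hv, hw] with a h1 h2
    rw [inner_add_right, h1, h2, add_zero]
  zero_mem' := by simp
  smul_mem' c v hv := by
    change ∀ᵐ a ∂μ, _ = 0 at hv ⊢
    filter_upwards [hv] with a h1
    rw [real_inner_smul_right, h1, mul_zero]

theorem integrable_norm_sub (hfin : ∀ x, laplaceT μ x ≠ ⊤) (y : EuclideanSpace ℝ (Fin n)) :
    Integrable (fun a => ‖a - y‖) μ := by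
  have h1 : Integrable (fun a => a) μ := by simpa using integrable_exp_inner_smul hfin 0
  have : IsFiniteMeasure μ := by
    have := integrable_exp_inner hfin 0
    simpa [integrable_const_iff] using this
  exact (h1.sub (integrable_const y)).norm

theorem integrable_max_inner (hfin : ∀ x, laplaceT μ x ≠ ⊤) (y v : EuclideanSpace ℝ (Fin n)) :
    Integrable (fun a => max ⟪a - y, v⟫ 0) μ := by
  refine ((integrable_norm_sub hfin y).mul_const ‖v‖).mono' (by fun_prop) (ae_of_all _ fun a => ?_)
  rw [Real.norm_of_nonneg (le_max_right _ _)]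
  exact max_le (real_inner_le_norm _ _) (by positivity)

theorem continuous_integral_max_inner (hfin : ∀ x, laplaceT μ x ≠ ⊤)
    (y : EuclideanSpace ℝ (Fin n)) :
    Continuous fun v => ∫ a, max ⟪a - y, v⟫ 0 ∂μ := by
  rw [continuous_iff_continuousAt]
  intro v
  refine continuousAt_of_dominated (bound := fun a => ‖a - y‖ * (‖v‖ + 1))
    (Eventually.of_forall fun w => (integrable_max_inner hfin y w).aestronglyMeasurable) ?_
    ((integrable_norm_sub hfin y).mul_const _) (ae_of_all _ fun a => by fun_prop)
  filter_upwards [Metric.ball_mem_nhds v one_pos] with w hw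
  refine ae_of_all _ fun a => ?_
  have h2 := norm_le_norm_add_norm_sub' w v
  rw [Metric.mem_ball, dist_eq_norm] at hw
  rw [Real.norm_of_nonneg (le_max_right _ _)]
  refine max_le ((real_inner_le_norm _ _).trans ?_) (by positivity)
  gcongr
  linarith

theorem exists_mul_norm_le_integral_max_inner (hfin : ∀ x, laplaceT μ x ≠ ⊤)
    {y : EuclideanSpace ℝ (Fin n)}
    (hy : ∀ v, (∀ᵐ a ∂μ, ⟪a - y, v⟫ ≤ 0) → ∀ᵐ a ∂μ, ⟪a - y, v⟫ = 0) :
    ∃ c > 0, ∀ v ∈ (aeOrthogonal μ y)ᗮ, c * ‖v‖ ≤ ∫ a, max ⟪a - y, v⟫ 0 ∂μ := by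
  set W := (aeOrthogonal μ y)ᗮ
  set h : EuclideanSpace ℝ (Fin n) → ℝ := fun v => ∫ a, max ⟪a - y, v⟫ 0 ∂μ with hh
  have hpos : ∀ v ∈ W, v ≠ 0 → 0 < h v := by
    intro v hv hv0
    refine lt_of_le_of_ne (integral_nonneg fun a => le_max_right _ _) fun h0 => hv0 ?_
    have h1 := (integral_eq_zero_iff_of_nonneg (fun a => le_max_right _ _)
      (integrable_max_inner hfin y v)).1 h0.symm
    have h2 : v ∈ aeOrthogonal μ y := hy v (h1.mono fun a ha => max_eq_right_iff.1 ha)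
    exact inner_self_eq_zero.1 (hv v h2)
  have hsmul : ∀ t : ℝ, 0 ≤ t → ∀ v, h (t • v) = t * h v := by
    intro t ht v
    simp only [hh, real_inner_smul_right, ← integral_const_mul, mul_max_of_nonneg _ _ ht, mul_zero]
  have hcomp : IsCompact (Metric.sphere 0 1 ∩ (W : Set (EuclideanSpace ℝ (Fin n)))) :=
    (isCompact_sphere _ _).inter_right W.closed_of_finiteDimensional
  obtain ⟨c, hc, hle⟩ := hcomp.exists_forall_le' (a := 0)
    (continuous_integral_max_inner hfin y).continuousOn fun v hv =>
      hpos v hv.2 (by rintro rfl; simpa using hv.1)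
  refine ⟨c, hc, fun v hv => ?_⟩
  rcases eq_or_ne v 0 with rfl | hv0
  · simp
  have h1 := hle (‖v‖⁻¹ • v) ⟨by simp [norm_smul, hv0], W.smul_mem _ hv⟩
  change c ≤ h _ at h1
  rw [hsmul _ (by positivity)] at h1
  change _ ≤ h v
  have : 0 < ‖v‖ := norm_pos_iff.2 hv0
  rwa [inv_mul_eq_div, le_div_iff₀ this] at h1

theorem exists_gradient_log_laplaceT_eq (hμ : μ ≠ 0) (hfin : ∀ x, laplaceT μ x ≠ ⊤)
    {y : EuclideanSpace ℝ (Fin n)}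
    (hy : ∀ v, (∀ᵐ a ∂μ, ⟪a - y, v⟫ ≤ 0) → ∀ᵐ a ∂μ, ⟪a - y, v⟫ = 0) :
    ∃ x, ∇ (fun x => Real.log (laplaceT μ x).toReal) x = y := by
  obtain ⟨c, hc, hle⟩ := exists_mul_norm_le_integral_max_inner hfin hy
  set W := (aeOrthogonal μ y)ᗮ with hW
  let φ : EuclideanSpace ℝ (Fin n) → ℝ := fun x => Real.log (laplaceT μ x).toReal - ⟪y, x⟫
  have hφ : ∀ x, HasFDerivAt φ (InnerProductSpace.toDual ℝ _
      (∇ (fun x => Real.log (laplaceT μ x).toReal) x - y)) x := fun x => by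
    rw [map_sub]
    exact (hasGradientAt_log_laplaceT hμ hfin x).differentiableAt.hasGradientAt.hasFDerivAt.sub
      (innerSL ℝ y).hasFDerivAt
  have hexp : ∀ x, Real.exp (φ x) = ∫ a, Real.exp ⟪a - y, x⟫ ∂μ := fun x => by
    simp only [φ, laplaceT_toReal, inner_sub_left, Real.exp_sub, integral_div]
    rw [Real.exp_log (integral_exp_inner_pos hμ hfin x)]
  have hint : ∀ x, Integrable (fun a => Real.exp ⟪a - y, x⟫) μ := fun x => by
    simp only [inner_sub_left, Real.exp_sub]
    exact (integrable_exp_inner hfin x).div_const _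
  have hlow : ∀ x : W, c * ‖x‖ ≤ Real.exp (φ x) := fun x => by
    rw [hexp]
    refine (hle x x.2).trans (integral_mono (integrable_max_inner hfin y x) (hint x) fun a => ?_)
    exact max_le (by linarith [Real.add_one_le_exp ⟪a - y, x⟫]) (Real.exp_pos _).le
  have hlim : Tendsto (fun x : W => Real.exp (φ x)) (cocompact W) atTop :=
    tendsto_atTop_mono hlow ((tendsto_norm_cocompact_atTop (E := W)).const_mul_atTop hc)
  have hcont : Continuous φ := continuous_iff_continuousAt.2 fun x => (hφ x).continuousAt
  obtain ⟨x, hx⟩ := Continuous.exists_forall_le (f := fun x : W => Real.exp (φ x))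
    (by fun_prop) hlim
  have hmin : IsLocalMin (φ ∘ W.subtypeL) x :=
    Eventually.of_forall fun z => Real.exp_le_exp.1 (hx z)
  have hd := hmin.hasFDerivAt_eq_zero ((hφ x).comp x W.subtypeL.hasFDerivAt)
  set g := ∇ (fun x => Real.log (laplaceT μ x).toReal) x with hg
  have h1 : g - y ∈ Wᗮ := fun w hw => by
    have := DFunLike.congr_fun hd ⟨w, hw⟩
    rw [real_inner_comm, inner_sub_left]
    simpa using this
  have h2 : g - y ∈ W := fun w hw => by
    have h3 := inner_gradient_sub hμ hfin x y w
    rw [integral_eq_zero_of_ae, eq_comm, mul_eq_zero, ← hg] at h3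
    · rw [real_inner_comm]
      exact h3.resolve_left (integral_exp_inner_pos hμ hfin x).ne'
    · have hw' : ∀ᵐ a ∂μ, ⟪a - y, w⟫ = 0 := hw
      filter_upwards [hw'] with a ha
      simp [ha]
  exact ⟨x, sub_eq_zero.1 (inner_self_eq_zero.1 (h1 _ h2))⟩

end Laplace

end Auxiliary

/-- Let `μ` be a nonzero positive Borel measure on `ℝⁿ` whose Laplace
transform is everywhere finite.  Then the image of `ℝⁿ` under the gradient of `log L(μ)`
equals the relative interior (intrinsic interior) of `C_μ`, the closed convex hull of the
support of `μ`. -/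
theorem gradient_logLaplace_range_eq_algint_Cmu
    {n : ℕ} (μ : Measure (EuclideanSpace ℝ (Fin n)))
    (hμ : μ ≠ 0)
    (hfin : ∀ x, laplaceT μ x ≠ ⊤) :
    Set.range (gradient (fun x => Real.log (laplaceT μ x).toReal)) =
      intrinsicInterior ℝ (closure (convexHull ℝ (measSupport μ))) := by
  ext y
  constructor
  · rintro ⟨x, rfl⟩
    exact gradient_log_laplaceT_mem hμ hfin x
  · intro hy
    exact exists_gradient_log_laplaceT_eq hμ hfin
      ((mem_intrinsicInterior_closure_convexHull_measSupport μ hμ).1 hy)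
end
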